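/- Fix n ≥ 2 and consider n+2 qubits with sites A = {1,…,n} together with two sites a and b. For a real weight x with x ≤ (n+2)²/(4(n+1)), set s := √((n+2)² − 4(n+1)x) and let H_x = Σ_{i ∈ A}(H_{ia} + H_{ib}) + x·H_{ab} be the weighted crown-graph Hamiltonian. Then for either choice of sign ε ∈ {+1, −1}, the sum-of-squares matrix identity holds: (n+1)·I − H_x = (2/(n+1))·Σ_{k ∈ {a,b}} (((n+1)/2)·I − Σ_{i ∈ A} H_{ik} − ((2 + n + ε·s)/4)·H_{ab})² + (2/(n+1))·Σ_{i < j ∈ A} H_{ij}. In particular (n+1)·I − H_x is positive semidefinite, so λ_max(H_x) ≤ n+1 for all x ≤ (n+2)²/(4(n+1)). -/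

import Mathlib

open Matrix Finset
open scoped ComplexOrder

noncomputable section

/-- The SWAP matrix on qubits indexed by `V`, exchanging tensor factors `i` and `j`. -/
def swapMat {V : Type*} [Fintype V] [DecidableEq V] (i j : V) :
    Matrix (V → Fin 2) (V → Fin 2) ℂ :=
  Matrix.of fun f g => if f ∘ (Equiv.swap i j) = g then 1 else 0

/-- The singlet projector `H_{ij} = (I - P_{ij})/2`. -/
def singletProj {V : Type*} [Fintype V] [DecidableEq V] (i j : V) :
    Matrix (V → Fin 2) (V → Fin 2) ℂ :=
  (2 : ℂ)⁻¹ • (1 - swapMat i j)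

/-- The weighted crown-graph Hamiltonian on `n+2` qubits, with leaves `Sum.inl i`,
centers `a = Sum.inr 0`, `b = Sum.inr 1`, and center-edge weight `x`. -/
def crownHam (n : ℕ) (x : ℝ) :
    Matrix ((Fin n ⊕ Fin 2) → Fin 2) ((Fin n ⊕ Fin 2) → Fin 2) ℂ :=
  ∑ i : Fin n, (singletProj (Sum.inl i) (Sum.inr 0) + singletProj (Sum.inl i) (Sum.inr 1))
    + (x : ℂ) • singletProj (Sum.inr 0 : Fin n ⊕ Fin 2) (Sum.inr 1)

section QubitSwap

variable {V : Type*} [Fintype V] [DecidableEq V]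

theorem swapMat_mul_apply (i j : V) (M : Matrix (V → Fin 2) (V → Fin 2) ℂ) (f g : V → Fin 2) :
    (swapMat i j * M) f g = M (f ∘ Equiv.swap i j) g := by
  simp [Matrix.mul_apply, swapMat]

theorem swapMat_self (i : V) : swapMat i i = 1 := by
  ext f g
  simp [swapMat, Matrix.one_apply]

theorem swapMat_comm (i j : V) : swapMat i j = swapMat j i := by
  simp [swapMat, Equiv.swap_comm]

theorem swapMat_mul_self (i j : V) : swapMat i j * swapMat i j = 1 := by
  ext f g
  rw [swapMat_mul_apply]
  have h : (f ∘ Equiv.swap i j) ∘ Equiv.swap i j = f := by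
    ext v
    simp
  simp [swapMat, Matrix.one_apply, h]

theorem isHermitian_swapMat (i j : V) : (swapMat i j).IsHermitian := by
  ext f g
  have h : g ∘ Equiv.swap i j = f ↔ f ∘ Equiv.swap i j = g := by
    constructor <;> rintro rfl <;> ext v <;> simp
  simp [swapMat, Matrix.conjTranspose_apply, h, apply_ite]

/-- On qubits the antisymmetrizer of three sites vanishes. -/
theorem swapMat_mul_add_mul_swapMat {i j k : V} (hij : i ≠ j) (hjk : j ≠ k) (hik : i ≠ k) :
    swapMat i k * swapMat j k + swapMat j k * swapMat i k
      = swapMat i k + swapMat j k + swapMat i j - 1 := by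
  ext f g
  rw [Matrix.add_apply, swapMat_mul_apply, swapMat_mul_apply]
  simp only [swapMat, Matrix.sub_apply, Matrix.add_apply, Matrix.of_apply, Matrix.one_apply]
  have hcases : f i = f j ∨ f j = f k ∨ f i = f k := by
    generalize f i = p, f j = q, f k = r
    decide +revert
  rcases hcases with h | h | h
  · have h1 : f ∘ Equiv.swap i j = f := by
      ext v; simp only [Function.comp_apply, Equiv.swap_apply_def]; split_ifs <;> simp_all
    have h2 : (f ∘ Equiv.swap i k) ∘ Equiv.swap j k = f ∘ Equiv.swap i k := by
      ext v; simp only [Function.comp_apply, Equiv.swap_apply_def]; split_ifs <;> simp_all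
    have h3 : (f ∘ Equiv.swap j k) ∘ Equiv.swap i k = f ∘ Equiv.swap j k := by
      ext v; simp only [Function.comp_apply, Equiv.swap_apply_def]; split_ifs <;> simp_all
    rw [h1, h2, h3]; ring
  · have h1 : f ∘ Equiv.swap j k = f := by
      ext v; simp only [Function.comp_apply, Equiv.swap_apply_def]; split_ifs <;> simp_all
    have h2 : (f ∘ Equiv.swap i k) ∘ Equiv.swap j k = f ∘ Equiv.swap i j := by
      ext v; simp only [Function.comp_apply, Equiv.swap_apply_def]; split_ifs <;> simp_all
    rw [h1, h2]; ring
  · have h1 : f ∘ Equiv.swap i k = f := by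
      ext v; simp only [Function.comp_apply, Equiv.swap_apply_def]; split_ifs <;> simp_all
    have h3 : (f ∘ Equiv.swap j k) ∘ Equiv.swap i k = f ∘ Equiv.swap i j := by
      ext v; simp only [Function.comp_apply, Equiv.swap_apply_def]; split_ifs <;> simp_all
    rw [h1, h3]; ring

theorem isHermitian_singletProj (i j : V) : (singletProj i j).IsHermitian := by
  have h := isHermitian_swapMat i j
  simp only [Matrix.IsHermitian] at h ⊢
  simp [singletProj, Matrix.conjTranspose_smul, h]

theorem singletProj_self (i : V) : singletProj i i = 0 := by
  simp [singletProj, swapMat_self]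

theorem singletProj_comm (i j : V) : singletProj i j = singletProj j i := by
  simp [singletProj, swapMat_comm i j]

theorem singletProj_mul_self (i j : V) : singletProj i j * singletProj i j = singletProj i j := by
  simp only [singletProj, smul_mul_assoc, mul_smul_comm, sub_mul, mul_sub, one_mul, mul_one,
    swapMat_mul_self]
  module

theorem posSemidef_singletProj (i j : V) : (singletProj i j).PosSemidef := by
  have h := Matrix.posSemidef_conjTranspose_mul_self (singletProj i j)
  rwa [(isHermitian_singletProj i j).eq, singletProj_mul_self] at h

theorem singletProj_mul_add_mul_singletProj {i j k : V} (hij : i ≠ j) (hjk : j ≠ k) (hik : i ≠ k) :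
    singletProj i k * singletProj j k + singletProj j k * singletProj i k
      = (2 : ℂ)⁻¹ • (singletProj i k + singletProj j k - singletProj i j) := by
  have h := swapMat_mul_add_mul_swapMat hij hjk hik
  have hexp : singletProj i k * singletProj j k + singletProj j k * singletProj i k
      = (4 : ℂ)⁻¹ • ((2 : ℂ) • 1 - (2 : ℂ) • swapMat i k - (2 : ℂ) • swapMat j k
        + (swapMat i k * swapMat j k + swapMat j k * swapMat i k)) := by
    simp only [singletProj, smul_mul_assoc, mul_smul_comm, sub_mul, mul_sub, one_mul, mul_one]
    module
  rw [hexp, h]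
  simp only [singletProj]
  module

variable {n : ℕ}

/-- The square of a star Hamiltonian, in terms of the star and the complete graph on its leaves. -/
theorem sum_singletProj_mul_self {e : Fin n → V} (he : Function.Injective e) {k : V}
    (hk : ∀ i, e i ≠ k) :
    (∑ i, singletProj (e i) k) * (∑ i, singletProj (e i) k)
      = (((n : ℂ) + 1) / 2) • (∑ i, singletProj (e i) k)
        - (2 : ℂ)⁻¹ • ∑ i, ∑ j ∈ Finset.Ioi i, singletProj (e i) (e j) := by
  have hpair : ∀ i j, singletProj (e i) k * singletProj (e j) k
        + singletProj (e j) k * singletProj (e i) k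
      = (2 : ℂ)⁻¹ • (singletProj (e i) k + singletProj (e j) k - singletProj (e i) (e j))
        + if i = j then singletProj (e i) k else 0 := by
    intro i j
    by_cases h : i = j
    · subst h
      simp only [singletProj_mul_self, singletProj_self, if_true]
      module
    · rw [singletProj_mul_add_mul_singletProj (he.ne h) (hk j) (hk i), if_neg h, add_zero]
  have hcomplete : ∑ i, ∑ j, singletProj (e i) (e j)
      = (2 : ℂ) • ∑ i, ∑ j ∈ Finset.Ioi i, singletProj (e i) (e j) := by
    have h := Finset.sum_sum_Ioi_add_eq_sum_sum_off_diag fun i j => singletProj (e i) (e j)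
    have hoff : ∀ i, ∑ j ∈ {i}ᶜ, singletProj (e j) (e i) = ∑ j, singletProj (e i) (e j) := by
      intro i
      rw [← Finset.sum_compl_add_sum {i}]
      simp [singletProj_self, singletProj_comm (e i)]
    simp only [hoff] at h
    rw [← h, Finset.smul_sum]
    refine Finset.sum_congr rfl fun i _ => ?_
    rw [Finset.smul_sum]
    refine Finset.sum_congr rfl fun j _ => ?_
    rw [singletProj_comm (e j), two_smul]
  have hsum : ∑ i, ∑ j, (singletProj (e i) k * singletProj (e j) k
        + singletProj (e j) k * singletProj (e i) k)
      = (2 : ℂ) • ((∑ i, singletProj (e i) k) * (∑ i, singletProj (e i) k)) := by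
    simp only [Finset.sum_add_distrib, ← Finset.mul_sum, ← Finset.sum_mul, two_smul]
  simp only [hpair, Finset.sum_add_distrib, Finset.sum_sub_distrib, ← Finset.smul_sum, hcomplete,
    Finset.sum_ite_eq, Finset.mem_univ, if_true, Finset.sum_const, Finset.card_univ,
    Fintype.card_fin] at hsum
  rw [← Nat.cast_smul_eq_nsmul ℂ] at hsum
  have h2 := congrArg (fun M => (2 : ℂ)⁻¹ • M) hsum
  simp only [smul_smul, inv_mul_cancel₀ (two_ne_zero' ℂ), one_smul] at h2
  rw [← h2]
  module

theorem sum_singletProj_mul_add_mul {e : Fin n → V} {k l : V} (hk : ∀ i, e i ≠ k)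
    (hl : ∀ i, e i ≠ l) (hkl : k ≠ l) :
    (∑ i, singletProj (e i) k) * singletProj k l + singletProj k l * (∑ i, singletProj (e i) k)
      = (2 : ℂ)⁻¹ • ((∑ i, singletProj (e i) k) + (n : ℂ) • singletProj k l
        - ∑ i, singletProj (e i) l) := by
  have h : ∀ i, singletProj (e i) k * singletProj k l + singletProj k l * singletProj (e i) k
      = (2 : ℂ)⁻¹ • (singletProj (e i) k + singletProj k l - singletProj (e i) l) := by
    intro i
    rw [singletProj_comm k l]
    exact singletProj_mul_add_mul_singletProj (hl i) hkl.symm (hk i)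
  rw [Finset.sum_mul, Finset.mul_sum, ← Finset.sum_add_distrib, Finset.sum_congr rfl fun i _ => h i]
  simp only [← Finset.smul_sum, Finset.sum_sub_distrib, Finset.sum_add_distrib, Finset.sum_const,
    Finset.card_univ, Fintype.card_fin, Nat.cast_smul_eq_nsmul]

end QubitSwap

theorem sq_smul_one_sub_sub_smul {R : Type*} [Ring R] [Algebra ℂ R] (c t : ℂ) (S h : R)
    (hh : h * h = h) :
    (c • (1 : R) - S - t • h) ^ 2
      = (c ^ 2) • (1 : R) - (2 * c) • S + S * S + t • (S * h + h * S)
        + (t ^ 2 - 2 * c * t) • h := by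
  simp only [sq, mul_sub, sub_mul, smul_mul_assoc, mul_smul_comm, one_mul, mul_one, hh]
  module

/-- The two-star sum-of-squares identity; `2 * t` is a root of `z ^ 2 - (n + 2) * z + (n + 1) * x`. -/
theorem smul_one_sub_crownHam_eq (n : ℕ) (x : ℝ) (t : ℂ)
    (ht : 4 * t ^ 2 - 2 * ((n : ℂ) + 2) * t + ((n : ℂ) + 1) * x = 0) :
    ((n : ℂ) + 1) • (1 : Matrix ((Fin n ⊕ Fin 2) → Fin 2) ((Fin n ⊕ Fin 2) → Fin 2) ℂ)
        - crownHam n x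
      = (2 / ((n : ℂ) + 1)) • ∑ k : Fin 2,
          ((((n : ℂ) + 1) / 2) • 1
            - ∑ i : Fin n, singletProj (Sum.inl i : Fin n ⊕ Fin 2) (Sum.inr k)
            - t • singletProj (Sum.inr 0 : Fin n ⊕ Fin 2) (Sum.inr 1)) ^ 2
        + (2 / ((n : ℂ) + 1)) • ∑ i : Fin n, ∑ j ∈ Finset.Ioi i,
            singletProj (Sum.inl i : Fin n ⊕ Fin 2) (Sum.inl j) := by
  have hn : (n : ℂ) + 1 ≠ 0 := Nat.cast_add_one_ne_zero n
  have hstar : ∀ k : Fin 2, _ := fun k =>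
    sum_singletProj_mul_self (V := Fin n ⊕ Fin 2) (e := Sum.inl) Sum.inl_injective (k := Sum.inr k)
      fun _ => Sum.inl_ne_inr
  have ha := sum_singletProj_mul_add_mul (V := Fin n ⊕ Fin 2) (e := Sum.inl) (k := Sum.inr 0)
    (l := Sum.inr 1) (fun _ => Sum.inl_ne_inr) (fun _ => Sum.inl_ne_inr) (by simp)
  have hb := sum_singletProj_mul_add_mul (V := Fin n ⊕ Fin 2) (e := Sum.inl) (k := Sum.inr 1)
    (l := Sum.inr 0) (fun _ => Sum.inl_ne_inr) (fun _ => Sum.inl_ne_inr) (by simp)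
  rw [singletProj_comm (Sum.inr 1) (Sum.inr 0)] at hb
  have hx : (x : ℂ) = -(4 * t ^ 2 - 2 * ((n : ℂ) + 2) * t) / ((n : ℂ) + 1) := by
    rw [eq_div_iff hn]
    linear_combination ht
  have hsq := fun c S => sq_smul_one_sub_sub_smul c t S
    (singletProj (Sum.inr 0 : Fin n ⊕ Fin 2) (Sum.inr 1)) (singletProj_mul_self _ _)
  simp only [Fin.sum_univ_two, hsq, hstar, ha, hb, crownHam, Finset.sum_add_distrib, hx]
  match_scalars <;> field_simp <;> ring

theorem posSemidef_sq_of_isHermitian {m : Type*} [Fintype m] [DecidableEq m] {A : Matrix m m ℂ}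
    (hA : A.IsHermitian) : (A ^ 2).PosSemidef := by
  have h := Matrix.posSemidef_conjTranspose_mul_self A
  rwa [hA.eq, ← sq] at h

theorem eigenvalues_le_of_posSemidef {m : Type*} [Fintype m] [DecidableEq m] {A : Matrix m m ℂ}
    (hA : A.IsHermitian) {c : ℝ} (h : ((c : ℂ) • (1 : Matrix m m ℂ) - A).PosSemidef) (y : m) :
    hA.eigenvalues y ≤ c := by
  have hv := hA.mulVec_eigenvectorBasis y
  set v : m → ℂ := ⇑(hA.eigenvectorBasis y)
  have hnorm : star v ⬝ᵥ v = 1 := by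
    have h1 := hA.eigenvectorBasis.orthonormal.1 y
    have h2 := inner_self_eq_norm_sq_to_K (𝕜 := ℂ) (hA.eigenvectorBasis y)
    rw [h1, EuclideanSpace.inner_eq_star_dotProduct] at h2
    rw [dotProduct_comm]
    simpa using h2
  have hq := h.dotProduct_mulVec_nonneg v
  rw [Matrix.sub_mulVec, Matrix.smul_mulVec, Matrix.one_mulVec, hv, dotProduct_sub,
    dotProduct_smul, dotProduct_smul, hnorm] at hq
  simp only [smul_eq_mul, mul_one, Complex.real_smul] at hq
  have : (hA.eigenvalues y : ℂ) ≤ c := sub_nonneg.mp hq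
  exact_mod_cast this

/-- Level-1 sum-of-squares identity for the weighted crown graph whenever
`x ≤ (n+2)²/(4(n+1))`, for either choice of sign `ε ∈ {+1, −1}`.  In particular
`(n+1)·I − H_x` is positive semidefinite, so `λ_max(H_x) ≤ n+1`. -/
theorem stmt10 (n : ℕ) (hn : 2 ≤ n) (x : ℝ)
    (hx : x ≤ ((n : ℝ) + 2) ^ 2 / (4 * ((n : ℝ) + 1)))
    (ε : ℝ) (hε : ε = 1 ∨ ε = -1)
    (hH : (crownHam n x).IsHermitian) :
    (((n : ℂ) + 1) • (1 : Matrix ((Fin n ⊕ Fin 2) → Fin 2) ((Fin n ⊕ Fin 2) → Fin 2) ℂ)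
        - crownHam n x
      = (2 / ((n : ℂ) + 1)) • ∑ k : Fin 2,
          ((((n : ℂ) + 1) / 2) • 1
            - ∑ i : Fin n, singletProj (Sum.inl i : Fin n ⊕ Fin 2) (Sum.inr k)
            - (((2 + (n : ℝ) + ε * Real.sqrt (((n : ℝ) + 2) ^ 2 - 4 * ((n : ℝ) + 1) * x)) / 4 : ℝ) : ℂ)
                • singletProj (Sum.inr 0 : Fin n ⊕ Fin 2) (Sum.inr 1)) ^ 2
        + (2 / ((n : ℂ) + 1)) • ∑ i : Fin n, ∑ j ∈ Finset.Ioi i,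
            singletProj (Sum.inl i : Fin n ⊕ Fin 2) (Sum.inl j)) ∧
    (((n : ℂ) + 1) • (1 : Matrix ((Fin n ⊕ Fin 2) → Fin 2) ((Fin n ⊕ Fin 2) → Fin 2) ℂ)
      - crownHam n x).PosSemidef ∧
    (⨆ y, hH.eigenvalues y) ≤ (n : ℝ) + 1 := by
  set s := Real.sqrt (((n : ℝ) + 2) ^ 2 - 4 * ((n : ℝ) + 1) * x)
  have hs2 : s ^ 2 = ((n : ℝ) + 2) ^ 2 - 4 * ((n : ℝ) + 1) * x := by
    refine Real.sq_sqrt ?_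
    rw [le_div_iff₀ (by positivity)] at hx
    linarith
  have hε2 : ε ^ 2 = 1 := by rcases hε with rfl | rfl <;> norm_num
  set t := (2 + (n : ℝ) + ε * s) / 4 with ht
  have hroot : 4 * t ^ 2 - 2 * ((n : ℝ) + 2) * t + ((n : ℝ) + 1) * x = 0 := by
    rw [ht]
    linear_combination (1 / 4) * s ^ 2 * hε2 + (1 / 4) * hs2
  have hsos := smul_one_sub_crownHam_eq n x t (by exact_mod_cast hroot)
  have hc : (0 : ℂ) ≤ 2 / ((n : ℂ) + 1) := by
    have h : (0 : ℝ) ≤ 2 / ((n : ℝ) + 1) := by positivity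
    simpa using Complex.zero_le_real.mpr h
  have hpsd : (((n : ℂ) + 1) • (1 : Matrix ((Fin n ⊕ Fin 2) → Fin 2) ((Fin n ⊕ Fin 2) → Fin 2) ℂ)
      - crownHam n x).PosSemidef := by
    rw [hsos]
    refine Matrix.PosSemidef.add (Matrix.PosSemidef.smul ?_ hc) (Matrix.PosSemidef.smul ?_ hc)
    · refine Matrix.posSemidef_sum _ fun k _ => ?_
      refine posSemidef_sq_of_isHermitian (Matrix.IsHermitian.sub (Matrix.IsHermitian.sub ?_ ?_) ?_)
      · refine Matrix.IsHermitian.smul Matrix.isHermitian_one ?_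
        simp [isSelfAdjoint_iff]
      · exact isSelfAdjoint_sum _ fun i _ => isHermitian_singletProj _ _
      · exact (isHermitian_singletProj _ _).smul (by simp [isSelfAdjoint_iff])
    · exact Matrix.posSemidef_sum _ fun i _ =>
        Matrix.posSemidef_sum _ fun j _ => posSemidef_singletProj _ _
  exact ⟨hsos, hpsd, ciSup_le fun y => eigenvalues_le_of_posSemidef hH (by exact_mod_cast hpsd) y⟩


end
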